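/- arXiv:2604.08205 — 6 statements merged into one kernel-verified Lean document; each statement's English description precedes it below -/
import Mathlib

section
/- There exists a constant C ≥ 1 such that the following holds. Let B ≥ 4.2 be a real number and set b = B / ln B. For every finite list σ = (σ_1, …, σ_n) of real numbers with 1 ≤ |σ_i| ≤ b for all i, we have Opt(σ) ≤ C · (ln B) · Exp(σ) + C · B, where Exp(σ) is the number of items accepted by the Exp algorithm run on σ starting from state 0, and Opt(σ) is the maximum length of a feasible sublist of σ. -/
open Classical in
/-- One step of the `Exp` algorithm with threshold parameter `b`:
the pair `(s, k)` holds the current state and the number of accepted items.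
An incoming item `x` is accepted iff `s * x < 0` or `|x| ≤ b * exp (-|s| / b)`. -/
noncomputable def expStep (b : ℝ) (p : ℝ × ℕ) (x : ℝ) : ℝ × ℕ :=
  if p.1 * x < 0 ∨ |x| ≤ b * Real.exp (-|p.1| / b) then (p.1 + x, p.2 + 1) else p

/-- Number of items accepted by the `Exp` algorithm on the list `σ`,
starting from state `0`. -/
noncomputable def expCount (b : ℝ) (σ : List ℝ) : ℕ :=
  (σ.foldl (expStep b) ((0 : ℝ), (0 : ℕ))).2

/-- A list is feasible (for capacity `B`, starting state `0`)
if all its prefix sums lie in `[-B, B]`. -/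
def Feasible (B : ℝ) (t : List ℝ) : Prop :=
  ∀ n : ℕ, (t.take n).sum ∈ Set.Icc (-B) B

/-- The potential on the side of nonnegative algorithm states: `o` is the state of the
offline solution and `s` the state of the algorithm. -/
noncomputable def halfPotential (B b s o : ℝ) : ℝ := (B + b - o) / b * Real.exp (s / b)

/-- The potential, extended symmetrically to all algorithm states. -/
noncomputable def potential (B b s o : ℝ) : ℝ :=
  if 0 ≤ s then halfPotential B b s o else halfPotential B b (-s) (-o)

/-- The largest increase of the potential per accepted item. -/
noncomputable def potentialBound (B b : ℝ) : ℝ := (2 * B + b) / b * Real.exp 1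

lemma halfPotential_nonneg {B b s o : ℝ} (hb : 0 < b) (ho : o ≤ B) :
    0 ≤ halfPotential B b s o := by
  have : 0 ≤ B + b - o := by linarith
  unfold halfPotential
  positivity

lemma potential_nonneg {B b s o : ℝ} (hb : 0 < b) (ho : |o| ≤ B) :
    0 ≤ potential B b s o := by
  have := abs_le.mp ho
  unfold potential
  split_ifs
  · exact halfPotential_nonneg hb (by linarith)
  · exact halfPotential_nonneg hb (by linarith)

lemma halfPotential_le_potentialBound {B b s o : ℝ} (hb : 0 < b) (hs : s ≤ b) (ho : |o| ≤ B) :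
    halfPotential B b s o ≤ potentialBound B b := by
  have h := abs_le.mp ho
  have hsb : s / b ≤ 1 := (div_le_one hb).mpr hs
  have h0 : 0 ≤ 2 * B + b := by linarith
  unfold halfPotential potentialBound
  gcongr
  linarith

lemma potential_le_potentialBound {B b s o : ℝ} (hb : 0 < b) (hs : |s| ≤ b) (ho : |o| ≤ B) :
    potential B b s o ≤ potentialBound B b := by
  have h := abs_le.mp hs
  unfold potential
  split_ifs
  · exact halfPotential_le_potentialBound hb h.2 ho
  · exact halfPotential_le_potentialBound hb (by linarith) (by rwa [abs_neg])

lemma potential_neg {B b s o : ℝ} (hs : s ≠ 0) :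
    potential B b (-s) (-o) = potential B b s o := by
  unfold potential
  rcases lt_or_gt_of_ne hs with h | h
  · rw [if_pos (by linarith), if_neg (by linarith)]
  · rw [if_neg (by linarith), if_pos h.le, neg_neg, neg_neg]

lemma exp_sub_one_le_mul_exp_one {u : ℝ} (hu : 0 ≤ u) (hu1 : u ≤ 1) :
    Real.exp u - 1 ≤ u * Real.exp 1 := by
  have h1 : 1 - u ≤ Real.exp (-u) := by linarith [Real.add_one_le_exp (-u)]
  have h2 : (1 - u) * Real.exp u ≤ 1 := by
    calc (1 - u) * Real.exp u ≤ Real.exp (-u) * Real.exp u := by gcongr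
      _ = 1 := by rw [← Real.exp_add]; simp
  have h3 : u * Real.exp u ≤ u * Real.exp 1 := by gcongr
  linarith

lemma halfPotential_add_le_of_nonneg {B b s x o o' : ℝ} (hb : 0 < b) (hx : 0 ≤ x) (hxb : x ≤ b)
    (hacc : x ≤ b * Real.exp (-s / b)) (ho : |o| ≤ B) (hoo' : o ≤ o') :
    halfPotential B b (s + x) o' ≤ halfPotential B b s o + potentialBound B b := by
  have h := abs_le.mp ho
  have hu : 0 ≤ x / b := by positivity
  have hu1 : x / b ≤ 1 := (div_le_one hb).mpr hxb
  have hsx : x / b * Real.exp (s / b) ≤ 1 := by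
    have h1 : x / b ≤ Real.exp (-s / b) := by rw [div_le_iff₀ hb]; linarith
    calc x / b * Real.exp (s / b) ≤ Real.exp (-s / b) * Real.exp (s / b) := by gcongr
      _ = 1 := by rw [← Real.exp_add, neg_div]; simp
  have hinc : Real.exp (s / b) * (Real.exp (x / b) - 1) ≤ Real.exp 1 := by
    calc Real.exp (s / b) * (Real.exp (x / b) - 1)
        ≤ Real.exp (s / b) * (x / b * Real.exp 1) := by
          gcongr
          exact exp_sub_one_le_mul_exp_one hu hu1
      _ = x / b * Real.exp (s / b) * Real.exp 1 := by ring
      _ ≤ 1 * Real.exp 1 := by gcongr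
      _ = Real.exp 1 := one_mul _
  have hA : (B + b - o) / b ≤ (2 * B + b) / b := by
    gcongr
    linarith
  have hA0 : 0 ≤ (B + b - o) / b := div_nonneg (by linarith) hb.le
  have hmain : (B + b - o) / b * (Real.exp (s / b) * (Real.exp (x / b) - 1))
      ≤ (2 * B + b) / b * Real.exp 1 :=
    (mul_le_mul_of_nonneg_left hinc hA0).trans
      (mul_le_mul_of_nonneg_right hA (Real.exp_pos 1).le)
  have hmono : halfPotential B b (s + x) o' ≤ halfPotential B b (s + x) o := by
    unfold halfPotential
    gcongr
  refine hmono.trans ?_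
  unfold halfPotential potentialBound
  rw [add_div, Real.exp_add]
  linarith

lemma halfPotential_add_le_of_nonpos {B b s x o o' : ℝ} (hb : 0 < b) (hx : x ≤ 0)
    (ho : |o| ≤ B) (hoo' : o + x ≤ o') :
    halfPotential B b (s + x) o' ≤ halfPotential B b s o := by
  have h := abs_le.mp ho
  have hmono : halfPotential B b (s + x) o' ≤ halfPotential B b (s + x) (o + x) := by
    unfold halfPotential
    gcongr
  refine hmono.trans ?_
  have hA : B + b - (o + x) ≤ (B + b - o) * Real.exp (-x / b) := by
    have h1 : -x / b + 1 ≤ Real.exp (-x / b) := Real.add_one_le_exp _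
    have h2 : b * (-x / b) = -x := by field_simp
    have h3 : 0 ≤ -x / b := div_nonneg (by linarith) hb.le
    calc B + b - (o + x) ≤ (B + b - o) * (-x / b + 1) := by nlinarith
      _ ≤ _ := mul_le_mul_of_nonneg_left h1 (by linarith)
  have hexp : Real.exp (-x / b) * Real.exp ((s + x) / b) = Real.exp (s / b) := by
    rw [← Real.exp_add]
    congr 1
    ring
  unfold halfPotential
  calc (B + b - (o + x)) / b * Real.exp ((s + x) / b)
      ≤ (B + b - o) * Real.exp (-x / b) / b * Real.exp ((s + x) / b) := by gcongr
    _ = (B + b - o) / b * (Real.exp (-x / b) * Real.exp ((s + x) / b)) := by ring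
    _ = _ := by rw [hexp]

lemma potentialBound_nonneg {B b : ℝ} (hb : 0 < b) (hB : 0 ≤ B) : 0 ≤ potentialBound B b := by
  unfold potentialBound
  positivity

lemma potential_accept_of_nonneg {B b s x o o' : ℝ} (hb : 0 < b) (hs : 0 ≤ s) (hxb : |x| ≤ b)
    (hacc : s * x < 0 ∨ |x| ≤ b * Real.exp (-|s| / b)) (ho : |o| ≤ B) (ho' : |o'| ≤ B)
    (hoo' : o' = o ∨ o' = o + x) :
    potential B b (s + x) o' ≤ potential B b s o + potentialBound B b := by
  have hD : 0 ≤ potentialBound B b := potentialBound_nonneg hb ((abs_nonneg o).trans ho)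
  have hxb' := abs_le.mp hxb
  by_cases hsx : 0 ≤ s + x
  · unfold potential
    rw [if_pos hsx, if_pos hs]
    rcases le_or_gt 0 x with hx | hx
    · refine halfPotential_add_le_of_nonneg hb hx hxb'.2 ?_ ho
        (by rcases hoo' with h | h <;> linarith)
      rcases hacc with h | h
      · exact absurd h (not_lt.mpr (mul_nonneg hs hx))
      · rwa [abs_of_nonneg hx, abs_of_nonneg hs] at h
    · have := halfPotential_add_le_of_nonpos (s := s) (o' := o') hb hx.le ho
        (by rcases hoo' with h | h <;> linarith)
      linarith
  · have h1 : |s + x| ≤ b := abs_le.mpr ⟨by linarith, by linarith⟩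
    linarith [potential_le_potentialBound hb h1 ho', potential_nonneg (s := s) hb ho]

/-- Accepting an item raises the potential by at most `potentialBound`, whether or not the
offline solution takes the item. -/
lemma potential_accept {B b s x o o' : ℝ} (hb : 0 < b) (hxb : |x| ≤ b)
    (hacc : s * x < 0 ∨ |x| ≤ b * Real.exp (-|s| / b)) (ho : |o| ≤ B) (ho' : |o'| ≤ B)
    (hoo' : o' = o ∨ o' = o + x) :
    potential B b (s + x) o' ≤ potential B b s o + potentialBound B b := by
  rcases le_or_gt 0 s with hs | hs
  · exact potential_accept_of_nonneg hb hs hxb hacc ho ho' hoo'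
  by_cases hsx : s + x = 0
  · have h1 : |s + x| ≤ b := by rw [hsx, abs_zero]; exact hb.le
    linarith [potential_le_potentialBound hb h1 ho', potential_nonneg (s := s) hb ho]
  · have h := potential_accept_of_nonneg (B := B) (s := -s) (x := -x) (o := -o) (o' := -o') hb
      (by linarith) (by rwa [abs_neg]) (by rwa [neg_mul_neg, abs_neg, abs_neg])
      (by rwa [abs_neg]) (by rwa [abs_neg])
      (by rcases hoo' with h | h
          · left; linarith
          · right; linarith)
    rwa [← neg_add, potential_neg hsx, potential_neg hs.ne] at h

lemma halfPotential_add_one_le {B b s x o : ℝ} (hb : 0 < b)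
    (hx : b * Real.exp (-s / b) < x) :
    halfPotential B b s (o + x) + 1 ≤ halfPotential B b s o := by
  have h1 : Real.exp (-s / b) ≤ x / b := by rw [le_div_iff₀ hb]; linarith
  have h2 : 1 ≤ x / b * Real.exp (s / b) := by
    calc (1 : ℝ) = Real.exp (-s / b) * Real.exp (s / b) := by
          rw [← Real.exp_add, neg_div]; simp
      _ ≤ _ := by gcongr
  have h3 : halfPotential B b s o - halfPotential B b s (o + x) = x / b * Real.exp (s / b) := by
    unfold halfPotential
    ring
  linarith

/-- If an item rejected by the algorithm is taken by the offline solution, the potential drops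
by at least one. -/
lemma potential_reject {B b s x o : ℝ} (hb : 0 < b) (hxb : |x| ≤ b)
    (hrej : ¬ (s * x < 0 ∨ |x| ≤ b * Real.exp (-|s| / b))) :
    potential B b s (o + x) + 1 ≤ potential B b s o := by
  push Not at hrej
  obtain ⟨hsx, hx⟩ := hrej
  unfold potential
  rcases lt_trichotomy s 0 with hs | rfl | hs
  · rw [if_neg (by linarith), if_neg (by linarith), neg_add]
    apply halfPotential_add_one_le hb
    have hx0 : x ≤ 0 := by
      by_contra! h
      exact absurd hsx (not_le.mpr (mul_neg_of_neg_of_pos hs h))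
    rwa [abs_of_nonpos hx0, abs_of_neg hs] at hx
  · simp at hx
    linarith
  · rw [if_pos hs.le, if_pos hs.le]
    apply halfPotential_add_one_le hb
    have hx0 : 0 ≤ x := nonneg_of_mul_nonneg_right hsx hs
    rwa [abs_of_nonneg hx0, abs_of_pos hs] at hx

theorem length_le_potential_add {B b : ℝ} (hb : 0 < b) {t σ : List ℝ} (hts : t.Sublist σ)
    (hσ : ∀ x ∈ σ, |x| ≤ b) (s o : ℝ) (k : ℕ) (ho : ∀ n : ℕ, |o + (t.take n).sum| ≤ B) :
    (t.length : ℝ) + (potentialBound B b + 1) * k ≤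
      potential B b s o + (potentialBound B b + 1) * ((σ.foldl (expStep b) (s, k)).2 : ℝ) := by
  induction hts generalizing s o k with
  | slnil =>
    have := potential_nonneg (s := s) hb (by simpa using ho 0)
    simpa using this
  | @cons t σ x _ ih =>
    have ho0 : |o| ≤ B := by simpa using ho 0
    have hx : |x| ≤ b := hσ x (by simp)
    have hσ' : ∀ y ∈ σ, |y| ≤ b := fun y hy => hσ y (by simp [hy])
    rw [List.foldl_cons]
    by_cases h : s * x < 0 ∨ |x| ≤ b * Real.exp (-|s| / b)
    · have hstep : expStep b (s, k) x = (s + x, k + 1) := if_pos h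
      rw [hstep]
      have h1 := ih hσ' (s + x) o (k + 1) ho
      have h2 := potential_accept hb hx h ho0 ho0 (Or.inl rfl)
      push_cast at h1
      linarith
    · have hstep : expStep b (s, k) x = (s, k) := if_neg h
      rw [hstep]
      exact ih hσ' s o k ho
  | @cons_cons t σ x _ ih =>
    have ho0 : |o| ≤ B := by simpa using ho 0
    have ho1 : |o + x| ≤ B := by simpa using ho 1
    have hx : |x| ≤ b := hσ x (by simp)
    have hσ' : ∀ y ∈ σ, |y| ≤ b := fun y hy => hσ y (by simp [hy])
    have ho' : ∀ n : ℕ, |o + x + (t.take n).sum| ≤ B := fun n => by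
      simpa [add_assoc] using ho (n + 1)
    rw [List.foldl_cons, List.length_cons]
    push_cast
    by_cases h : s * x < 0 ∨ |x| ≤ b * Real.exp (-|s| / b)
    · have hstep : expStep b (s, k) x = (s + x, k + 1) := if_pos h
      rw [hstep]
      have h1 := ih hσ' (s + x) (o + x) (k + 1) ho'
      have h2 := potential_accept hb hx h ho0 ho1 (Or.inr rfl)
      push_cast at h1
      linarith
    · have hstep : expStep b (s, k) x = (s, k) := if_neg h
      rw [hstep]
      have h1 := ih hσ' s (o + x) k ho'
      have h2 := potential_reject (B := B) (o := o) hb hx h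
      linarith

theorem stmt_0 :
    ∃ C : ℝ, 1 ≤ C ∧
      ∀ B : ℝ, 4.2 ≤ B →
        ∀ σ : List ℝ, (∀ x ∈ σ, 1 ≤ |x| ∧ |x| ≤ B / Real.log B) →
          ∀ t : List ℝ, t.Sublist σ → Feasible B t →
            (t.length : ℝ) ≤
              C * Real.log B * (expCount (B / Real.log B) σ : ℝ) + C * B := by
  refine ⟨10, by norm_num, fun B hB σ hσ t hts ht => ?_⟩
  have hB0 : 0 < B := by linarith
  have he := Real.exp_one_lt_d9
  have hL : 1 ≤ Real.log B := by
    rw [Real.le_log_iff_exp_le hB0]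
    linarith
  have hLB : Real.log B ≤ B := by linarith [Real.log_le_sub_one_of_pos hB0]
  have hb : 0 < B / Real.log B := by positivity
  have hD : potentialBound B (B / Real.log B) = (2 * Real.log B + 1) * Real.exp 1 := by
    unfold potentialBound
    field_simp
  have hD' : potentialBound B (B / Real.log B) + 1 ≤ 10 * Real.log B := by
    rw [hD]
    nlinarith
  have hfeas : ∀ n : ℕ, |0 + (t.take n).sum| ≤ B := fun n => by
    rw [zero_add]
    exact abs_le.mpr (ht n)
  have hP : potential B (B / Real.log B) 0 0 ≤ potentialBound B (B / Real.log B) :=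
    potential_le_potentialBound hb (by simpa using hb.le) (by simpa using hB0.le)
  have hmain := length_le_potential_add hb hts (fun x hx => (hσ x hx).2) 0 0 0 hfeas
  have hcount : (potentialBound B (B / Real.log B) + 1) * (expCount (B / Real.log B) σ : ℝ)
      ≤ 10 * Real.log B * (expCount (B / Real.log B) σ : ℝ) :=
    mul_le_mul_of_nonneg_right hD' (Nat.cast_nonneg _)
  rw [expCount] at hcount ⊢
  push_cast at hmain
  linarith
end

section
/- Let B ≥ 4.2 be a real number and set b = B / ln B. Let s ∈ [−B, B] and let x be a real number with 1 ≤ |x| ≤ b. If s·x < 0, or if |x| ≤ b·exp(−|s|/b), then s + x ∈ [−B, B]. -/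
open Real in
theorem log_four_point_two_bounds : 1.43 ≤ log 4.2 ∧ log 4.2 ≤ 1.437 := by
  have h : log (4.2 : ℝ) = 2 * log 2 + log 1.05 := by
    rw [show (4.2 : ℝ) = 2 ^ 2 * 1.05 by norm_num, log_mul (by norm_num) (by norm_num), log_pow]
    norm_num
  have hl := one_sub_inv_le_log_of_pos (x := (1.05 : ℝ)) (by norm_num)
  have hu := log_le_sub_one_of_pos (x := (1.05 : ℝ)) (by norm_num)
  have := log_two_gt_d9
  have := log_two_lt_d9
  norm_num at *
  constructor <;> linarith

open Real in
theorem log_one_point_four_three_lower_bound : 0.357 ≤ log 1.43 := by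
  have h : 2 * log (1.43 : ℝ) = log 2 + log 1.02245 := by
    rw [← log_mul (by norm_num) (by norm_num), show (2 : ℝ) * 1.02245 = 1.43 ^ 2 by norm_num,
      log_pow]
    norm_num
  have hl := one_sub_inv_le_log_of_pos (x := (1.02245 : ℝ)) (by norm_num)
  have := log_two_gt_d9
  norm_num at *
  linarith

open Real in
theorem log_le_mul_log_log {B : ℝ} (hB : 4.2 ≤ B) : log B ≤ B * log (log B) := by
  have hB0 : 0 < B := by linarith
  obtain ⟨hl, hu⟩ := log_four_point_two_bounds
  have hlog : 1.43 ≤ log B := hl.trans (log_le_log (by norm_num) hB)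
  have hloglog : 0.357 ≤ log (log B) :=
    log_one_point_four_three_lower_bound.trans (log_le_log (by norm_num) hlog)
  have htan := log_le_sub_one_of_pos (x := B / 4.2) (by positivity)
  rw [log_div hB0.ne' (by norm_num)] at htan
  have hmul := mul_le_mul_of_nonneg_left hloglog hB0.le
  norm_num at *
  linarith

open Real in
theorem add_le_mul_log_add_one {b t y : ℝ} (hy : 1 ≤ y) (hyb : y ≤ b)
    (h : y ≤ b * exp (-t / b)) : t + y ≤ b * log b + 1 := by
  have hy0 : 0 < y := by linarith
  have hb0 : 0 < b := by linarith
  have hlog := log_le_log hy0 h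
  rw [log_mul hb0.ne' (exp_pos _).ne', log_exp] at hlog
  have hmul := mul_le_mul_of_nonneg_left hlog hb0.le
  rw [mul_add, mul_div_cancel₀ _ hb0.ne'] at hmul
  have hlow : y - 1 ≤ b * log y := calc
    y - 1 = y * (1 - y⁻¹) := by field_simp
    _ ≤ y * log y := mul_le_mul_of_nonneg_left (one_sub_inv_le_log_of_pos hy0) hy0.le
    _ ≤ b * log y := mul_le_mul_of_nonneg_right hyb (log_nonneg hy)
  linarith

open Real in
theorem div_log_mul_log_add_one_le {B : ℝ} (hB : 4.2 ≤ B) :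
    B / log B * log (B / log B) + 1 ≤ B := by
  have hB0 : 0 < B := by linarith
  have hL : 0 < log B := log_pos (by linarith)
  have hkey := log_le_mul_log_log hB
  rw [log_div hB0.ne' hL.ne', div_mul_eq_mul_div, ← le_sub_iff_add_le, div_le_iff₀ hL]
  linarith

theorem stmt_1 (B : ℝ) (hB : 4.2 ≤ B) (b : ℝ) (hb : b = B / Real.log B)
    (s : ℝ) (hs : s ∈ Set.Icc (-B) B) (x : ℝ) (hx1 : 1 ≤ |x|) (hxb : |x| ≤ b)
    (hacc : s * x < 0 ∨ |x| ≤ b * Real.exp (-|s| / b)) :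
    s + x ∈ Set.Icc (-B) B := by
  rcases hacc with hneg | hle
  · have hL : 1 ≤ Real.log B :=
      le_trans (by norm_num) (log_four_point_two_bounds.1.trans (Real.log_le_log (by norm_num) hB))
    have hbB : b ≤ B := hb ▸ div_le_self (by linarith) hL
    obtain ⟨hxl, hxu⟩ := abs_le.mp (hxb.trans hbB)
    obtain ⟨hsl, hsu⟩ := hs
    rcases mul_neg_iff.mp hneg with ⟨h₁, h₂⟩ | ⟨h₁, h₂⟩ <;> constructor <;> linarith
  · have hsum := add_le_mul_log_add_one hx1 hxb hle
    have hbound := div_log_mul_log_add_one_le hB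
    rw [← hb] at hbound
    exact abs_le.mp ((abs_add_le s x).trans (hsum.trans hbound))
end

section
/- Let m and B be positive integers with m ≥ 1 and m dividing B, and let n be any natural number. Then there exists a finite list L of real numbers, each entry belonging to {m, 1, −m, −1}, such that Opt(L) ≥ n and Opt(L) ≥ m · Greedy(L), where Greedy(L) is the number of items accepted by the greedy algorithm on L starting from state 0 and Opt(L) is the maximum length of a feasible sublist of L. In particular the competitive ratio of the greedy algorithm is at least m. -/
open Classical in
/-- One step of the greedy algorithm with capacity `B`: the pair `(s, k)` holds the
current state and the number of accepted items; an incoming item `x` is accepted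
iff `s + x ∈ [-B, B]`. -/
noncomputable def greedyStep (B : ℝ) (p : ℝ × ℕ) (x : ℝ) : ℝ × ℕ :=
  if p.1 + x ∈ Set.Icc (-B) B then (p.1 + x, p.2 + 1) else p

/-- Number of items accepted by the greedy algorithm on `L`, starting from state `0`. -/
noncomputable def greedyCount (B : ℝ) (L : List ℝ) : ℕ :=
  (L.foldl (greedyStep B) ((0 : ℝ), (0 : ℕ))).2

theorem add_mul_mem_Icc {B s x : ℝ} {i N : ℕ} (hs : s ∈ Set.Icc (-B) B)
    (hN : s + N * x ∈ Set.Icc (-B) B) (hi : i ≤ N) : s + i * x ∈ Set.Icc (-B) B := by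
  have hi' : (i : ℝ) ≤ N := by exact_mod_cast hi
  have hi0 : (0 : ℝ) ≤ i := Nat.cast_nonneg i
  obtain ⟨h1, h2⟩ := hs
  obtain ⟨h3, h4⟩ := hN
  rcases le_total 0 x with hx | hx
  · have := mul_le_mul_of_nonneg_right hi' hx
    have := mul_nonneg hi0 hx
    constructor <;> linarith
  · have := mul_le_mul_of_nonpos_right hi' hx
    have := mul_nonpos_of_nonneg_of_nonpos hi0 hx
    constructor <;> linarith

theorem foldl_greedyStep_replicate_of_mem {B x : ℝ} (N : ℕ) {s : ℝ} {K : ℕ}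
    (hs : s ∈ Set.Icc (-B) B) (hN : s + N * x ∈ Set.Icc (-B) B) :
    (List.replicate N x).foldl (greedyStep B) (s, K) = (s + N * x, K + N) := by
  induction N generalizing s K with
  | zero => simp
  | succ N ih =>
    have h1 : s + x ∈ Set.Icc (-B) B := by
      simpa using add_mul_mem_Icc (i := 1) hs hN (by omega)
    have h2 : s + ((N + 1 : ℕ) : ℝ) * x = s + x + N * x := by push_cast; ring
    rw [h2] at hN ⊢
    have h3 : greedyStep B (s, K) x = (s + x, K + 1) := if_pos h1
    rw [List.replicate_succ, List.foldl_cons, h3, ih h1 hN]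
    congr 1
    omega

theorem foldl_greedyStep_replicate_of_notMem {B x : ℝ} (N : ℕ) {s : ℝ} {K : ℕ}
    (hs : s + x ∉ Set.Icc (-B) B) :
    (List.replicate N x).foldl (greedyStep B) (s, K) = (s, K) := by
  induction N with
  | zero => rfl
  | succ N ih =>
    have h : greedyStep B (s, K) x = (s, K) := if_neg hs
    rw [List.replicate_succ, List.foldl_cons, h, ih]

theorem Feasible.sum_mem {B : ℝ} {t : List ℝ} (ht : Feasible B t) :
    t.sum ∈ Set.Icc (-B) B := by
  simpa using ht t.length

theorem Feasible.append_replicate {B x : ℝ} {t : List ℝ} {N : ℕ} (ht : Feasible B t)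
    (hN : t.sum + N * x ∈ Set.Icc (-B) B) : Feasible B (t ++ List.replicate N x) := by
  intro n
  rw [List.take_append]
  rcases le_total n t.length with h | h
  · simpa [Nat.sub_eq_zero_of_le h] using ht n
  · rw [List.take_of_length_le h, List.take_replicate, List.sum_append, List.sum_replicate,
      nsmul_eq_mul]
    exact add_mul_mem_Icc ht.sum_mem hN (min_le_right _ _)

/-- Some list over `{±m, ±1}` brings the greedy algorithm to state `s`, while a feasible sublist of
length at least `n` also has sum `s` and is at least `m` times as long as the greedy one. -/
def IsAdversarialState (m B : ℕ) (s : ℝ) (n : ℕ) : Prop :=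
  ∃ (L t : List ℝ) (K : ℕ),
    (∀ x ∈ L, x = (m : ℝ) ∨ x = 1 ∨ x = -(m : ℝ) ∨ x = -1) ∧
    L.foldl (greedyStep B) ((0 : ℝ), (0 : ℕ)) = (s, K) ∧
    t.Sublist L ∧ Feasible (B : ℝ) t ∧ t.sum = s ∧ n ≤ t.length ∧ m * K ≤ t.length

theorem isAdversarialState_zero (m B : ℕ) : IsAdversarialState m B 0 0 := by
  refine ⟨[], [], 0, ?_, rfl, List.Sublist.refl _, ?_, ?_, ?_, ?_⟩ <;> simp [Feasible]

/-- Sending `j` items `ε * m` and then `j * m` items `ε` moves both algorithms to `ε * B`: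
the greedy one uses the large items, and its competitor the small ones. -/
theorem IsAdversarialState.step {m B : ℕ} {s ε : ℝ} {n j : ℕ} (h : IsAdversarialState m B s n)
    (hε : ε = 1 ∨ ε = -1) (hj : s + j * (ε * m) = ε * B) :
    IsAdversarialState m B (ε * B) (n + j * m) := by
  obtain ⟨L, t, K, hL, hfold, hsub, hfeas, rfl, hn, hK⟩ := h
  have hB : (0 : ℝ) ≤ B := Nat.cast_nonneg B
  have hmem : ε * B ∈ Set.Icc (-(B : ℝ)) B := by
    rcases hε with rfl | rfl <;> constructor <;> linarith
  have hnot : ε * B + ε ∉ Set.Icc (-(B : ℝ)) B := by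
    rintro ⟨h1, h2⟩
    rcases hε with rfl | rfl <;> linarith
  have hj' : t.sum + (j * m : ℕ) * ε = ε * B := by
    rw [← hj]; push_cast; ring
  refine ⟨L ++ (List.replicate j (ε * m) ++ List.replicate (j * m) ε),
    t ++ List.replicate (j * m) ε, K + j, ?_, ?_, ?_, ?_, ?_, ?_, ?_⟩
  · intro x hx
    rcases List.mem_append.1 hx with hx | hx
    · exact hL x hx
    · rcases List.mem_append.1 hx with hx | hx <;> rw [List.eq_of_mem_replicate hx] <;>
        rcases hε with rfl | rfl <;> simp
  · rw [List.foldl_append, List.foldl_append, hfold,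
      foldl_greedyStep_replicate_of_mem j hfeas.sum_mem (hj ▸ hmem), hj,
      foldl_greedyStep_replicate_of_notMem _ hnot]
  · exact hsub.append (List.sublist_append_right _ _)
  · exact hfeas.append_replicate (hj' ▸ hmem)
  · rw [List.sum_append, List.sum_replicate, nsmul_eq_mul, hj']
  · simpa using hn
  · rw [List.length_append, List.length_replicate, mul_add, mul_comm m j]
    omega

theorem stmt_3 (m B : ℕ) (hm : 1 ≤ m) (hB : 0 < B) (hmB : m ∣ B) (n : ℕ) :
    ∃ L : List ℝ,
      (∀ x ∈ L, x = (m : ℝ) ∨ x = 1 ∨ x = -(m : ℝ) ∨ x = -1) ∧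
      ∃ t : List ℝ, t.Sublist L ∧ Feasible (B : ℝ) t ∧
        n ≤ t.length ∧ m * greedyCount (B : ℝ) L ≤ t.length := by
  obtain ⟨k, rfl⟩ := hmB
  have hk : 0 < k := Nat.pos_of_mul_pos_left hB
  have key : ∀ n : ℕ, ∃ ε : ℝ, (ε = 1 ∨ ε = -1) ∧
      IsAdversarialState m (m * k) (ε * (m * k : ℕ)) n := by
    intro n
    induction n with
    | zero =>
      refine ⟨1, Or.inl rfl, ?_⟩
      obtain ⟨L, t, K, h1, h2, h3, h4, h5, -, h7⟩ :=
        (isAdversarialState_zero m (m * k)).step (j := k) (Or.inl rfl) (by push_cast; ring)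
      exact ⟨L, t, K, h1, h2, h3, h4, h5, Nat.zero_le _, h7⟩
    | succ n ih =>
      obtain ⟨ε, hε, h⟩ := ih
      have hε' : -ε = 1 ∨ -ε = -1 := by
        rcases hε with rfl | rfl <;> simp
      refine ⟨-ε, hε', ?_⟩
      obtain ⟨L, t, K, h1, h2, h3, h4, h5, h6, h7⟩ :=
        h.step (j := 2 * k) hε' (by push_cast; ring)
      have hpos : 0 < 2 * k * m := by positivity
      exact ⟨L, t, K, h1, h2, h3, h4, h5, by omega, h7⟩
  obtain ⟨ε, -, L, t, K, hL, hfold, hsub, hfeas, -, hn, hK⟩ := key n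
  refine ⟨L, hL, t, hsub, hfeas, hn, ?_⟩
  rw [greedyCount, hfold]
  exact hK
end

section
/- Define the sequence (U_n) of reals by U_0 = 1 and U_{n+1} = U_n · exp(1/U_n) for all n ∈ ℕ. Then for all n ∈ ℕ: n + (1/2)·ln(n+1) ≤ U_n ≤ n + (1/2)·ln(n+1) + 3. -/
noncomputable def U : ℕ → ℝ
  | 0 => 1
  | n + 1 => U n * Real.exp (1 / U n)

lemma exp_le_cubic {x : ℝ} (h0 : 0 ≤ x) (h1 : x ≤ 1) :
    Real.exp x ≤ 1 + x + x ^ 2 / 2 + x ^ 3 / 4 := by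
  have h := Real.exp_bound' h0 h1 (n := 3) (by norm_num)
  norm_num [Finset.sum_range_succ, Nat.factorial] at h
  nlinarith [pow_nonneg h0 3]

lemma add_half_le_mul_exp_inv {u : ℝ} (hu : 0 < u) :
    u + 1 + 1 / (2 * u) ≤ u * Real.exp (1 / u) := by
  have h := Real.quadratic_le_exp_of_nonneg (one_div_pos.mpr hu).le
  calc u + 1 + 1 / (2 * u) = u * (1 + 1 / u + (1 / u) ^ 2 / 2) := by field_simp
    _ ≤ _ := by gcongr

lemma mul_exp_inv_le {u : ℝ} (hu : 1 ≤ u) :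
    u * Real.exp (1 / u) ≤ u + 1 + 1 / (2 * u) + 1 / (4 * u ^ 2) := by
  have hu0 : 0 < u := by linarith
  have h := exp_le_cubic (one_div_pos.mpr hu0).le ((div_le_one hu0).mpr hu)
  calc u * Real.exp (1 / u)
      ≤ u * (1 + 1 / u + (1 / u) ^ 2 / 2 + (1 / u) ^ 3 / 4) := by gcongr
    _ = _ := by field_simp

lemma U_pos (n : ℕ) : 0 < U n := by
  induction n with
  | zero => simp [U]
  | succ n ih => rw [U]; positivity

lemma log_U_succ (n : ℕ) : Real.log (U (n + 1)) = Real.log (U n) + 1 / U n := by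
  rw [U, Real.log_mul (U_pos n).ne' (Real.exp_ne_zero _), Real.log_exp]

lemma one_le_U (n : ℕ) : 1 ≤ U n := by
  induction n with
  | zero => simp [U]
  | succ n ih =>
    have h := add_half_le_mul_exp_inv (U_pos n)
    have h' : 0 < 1 / (2 * U n) := by have := U_pos n; positivity
    rw [U]; linarith

lemma add_half_log_U_le (n : ℕ) : n + 1 + 1 / 2 * Real.log (U n) ≤ U n := by
  induction n with
  | zero => simp [U]
  | succ n ih =>
    have h := add_half_le_mul_exp_inv (U_pos n)
    have e : 1 / (2 * U n) = 1 / 2 * (1 / U n) := by have := U_pos n; field_simp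
    rw [log_U_succ, U]; push_cast; linarith

lemma add_one_le_U (n : ℕ) : (n : ℝ) + 1 ≤ U n := by
  linarith [add_half_log_U_le n, Real.log_nonneg (one_le_U n)]

lemma U_le_add_half_log_U (n : ℕ) :
    U n ≤ n + 3 / 2 - 1 / (4 * n + 2) + 1 / 2 * Real.log (U n) := by
  induction n with
  | zero => norm_num [U]
  | succ n ih =>
    have h := mul_exp_inv_le (one_le_U n)
    have e : 1 / (2 * U n) = 1 / 2 * (1 / U n) := by have := U_pos n; field_simp
    have h1 : 1 / (4 * U n ^ 2) ≤ 1 / (4 * ((n : ℝ) + 1) ^ 2) := by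
      have := add_one_le_U n
      gcongr
    have h2 : 1 / (4 * ((n : ℝ) + 1) ^ 2) ≤ 1 / (4 * n + 2) - 1 / (4 * (n + 1) + 2) := by
      rw [div_sub_div _ _ (by positivity) (by positivity),
        div_le_div_iff₀ (by positivity) (by positivity)]
      nlinarith
    rw [log_U_succ, U]; push_cast; linarith

theorem stmt_4 :
    ∀ n : ℕ, (n : ℝ) + (1 / 2) * Real.log (n + 1) ≤ U n ∧
      U n ≤ (n : ℝ) + (1 / 2) * Real.log (n + 1) + 3 := by
  intro n
  have hn : (0 : ℝ) < n + 1 := by positivity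
  constructor
  · linarith [add_half_log_U_le n, Real.log_le_log hn (add_one_le_U n)]
  · have h := U_le_add_half_log_U n
    have hpos : 0 < 1 / (4 * (n : ℝ) + 2) := by positivity
    have h2 : U n ≤ 2 * (n + 1) := by linarith [Real.log_le_sub_one_of_pos (U_pos n)]
    have h3 := Real.log_le_log (U_pos n) h2
    rw [Real.log_mul two_ne_zero hn.ne'] at h3
    linarith [Real.log_le_sub_one_of_pos (zero_lt_two (α := ℝ))]
end

section
/- For every natural number n ≥ 1, 1/(n + (1/2)·ln(n) + 3) ≥ 1/(n+3) − (1/2)·(n+3)^{−1.6}, where (n+3)^{−1.6} denotes the real power with exponent −1.6. -/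
lemma log_le_rpow_two_fifths {x : ℝ} (hx : 0 < x) : Real.log x ≤ x ^ (0.4 : ℝ) := by
  have hp : 0 < x ^ (0.4 : ℝ) := Real.rpow_pos_of_pos hx _
  have hlog : Real.log (x ^ (0.4 : ℝ)) = 0.4 * Real.log x := Real.log_rpow hx _
  have h := Real.log_le_sub_one_of_pos (show 0 < x ^ (0.4 : ℝ) * (2 / 5) by positivity)
  have he : Real.log (2 / 5 : ℝ) ≥ -1 := by
    rw [ge_iff_le, Real.le_log_iff_exp_le (by norm_num), Real.exp_neg,
      inv_le_comm₀ (Real.exp_pos 1) (by norm_num)]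
    linarith [Real.exp_one_gt_d9]
  rw [Real.log_mul hp.ne' (by norm_num), hlog] at h
  linarith

theorem stmt_10 (n : ℕ) (hn : 1 ≤ n) :
    1 / ((n : ℝ) + (1 / 2) * Real.log n + 3) ≥
      1 / ((n : ℝ) + 3) - (1 / 2) * ((n : ℝ) + 3) ^ (-1.6 : ℝ) := by
  have hn' : (1 : ℝ) ≤ n := by exact_mod_cast hn
  have hL : 0 ≤ Real.log n := Real.log_nonneg hn'
  have hm : (0 : ℝ) < n + 3 := by linarith
  have hLp : Real.log n ≤ ((n : ℝ) + 3) ^ (0.4 : ℝ) :=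
    (Real.log_le_log (by linarith) (by linarith)).trans (log_le_rpow_two_fifths hm)
  have hpow : ((n : ℝ) + 3) ^ (-1.6 : ℝ) = ((n : ℝ) + 3) ^ (0.4 : ℝ) / ((n : ℝ) + 3) ^ 2 := by
    rw [← Real.rpow_natCast, ← Real.rpow_sub hm]
    norm_num
  rw [hpow, show (n : ℝ) + 1 / 2 * Real.log n + 3 = n + 3 + Real.log n / 2 by ring]
  generalize (n : ℝ) + 3 = m at *
  generalize Real.log n = L at *
  have hdiff : 1 / m - 1 / (m + L / 2) = L / 2 / (m * (m + L / 2)) := by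
    field_simp
    ring
  have hle : L / 2 / (m * (m + L / 2)) ≤ m ^ (0.4 : ℝ) / 2 / m ^ 2 := by
    have : m ^ 2 ≤ m * (m + L / 2) := by nlinarith
    gcongr
  have : m ^ (0.4 : ℝ) / 2 / m ^ 2 = 1 / 2 * (m ^ (0.4 : ℝ) / m ^ 2) := by ring
  linarith
end

section
/- Let B > 0 be a real number, let q ≥ 1 be a natural number with 2^q ≤ B, let z be a natural number with 1 ≤ z ≤ q, and set s = ⌈2B / 2^q⌉. Then for every real s_0 with −B ≤ s_0 ≤ 0 there exists a natural number k with k ≤ 2^z · s such that k ≥ B · 2^{z−q−1}, and B/2 ≤ s_0 + k · 2^{q−z} ≤ B. -/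
theorem stmt_17 (B : ℝ) (hB : 0 < B) (q : ℕ) (hq : 1 ≤ q) (hqB : (2 : ℝ) ^ q ≤ B)
    (z : ℕ) (hz1 : 1 ≤ z) (hzq : z ≤ q) (s : ℕ) (hs : s = ⌈2 * B / 2 ^ q⌉₊) :
    ∀ s₀ : ℝ, -B ≤ s₀ → s₀ ≤ 0 →
      ∃ k : ℕ, k ≤ 2 ^ z * s ∧
        B * (2 : ℝ) ^ ((z : ℤ) - (q : ℤ) - 1) ≤ (k : ℝ) ∧
        B / 2 ≤ s₀ + (k : ℝ) * (2 : ℝ) ^ ((q : ℤ) - (z : ℤ)) ∧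
        s₀ + (k : ℝ) * (2 : ℝ) ^ ((q : ℤ) - (z : ℤ)) ≤ B := by
  intro s₀ h₁ h₂
  have hscale : (2 : ℝ) ^ ((z : ℤ) - (q : ℤ) - 1) = ((2 : ℝ) ^ ((q : ℤ) - (z : ℤ)))⁻¹ / 2 := by
    rw [zpow_sub_one₀ two_ne_zero, ← zpow_neg, neg_sub, div_eq_mul_inv]
  have hmul : (2 : ℝ) ^ ((q : ℤ) - (z : ℤ)) * 2 ^ z = 2 ^ q := by
    rw [zpow_sub₀ two_ne_zero, zpow_natCast, zpow_natCast]
    field_simp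
  have hd : (0 : ℝ) < 2 ^ ((q : ℤ) - (z : ℤ)) := by positivity
  rw [hscale]
  generalize (2 : ℝ) ^ ((q : ℤ) - (z : ℤ)) = d at hmul hd ⊢
  have hz2 : (2 : ℝ) ≤ 2 ^ z := le_self_pow₀ one_le_two (by omega)
  have hdB : 2 * d ≤ B := by nlinarith
  have hle : (⌊(B - s₀) / d⌋₊ : ℝ) * d ≤ B - s₀ :=
    (le_div_iff₀ hd).1 (Nat.floor_le (div_nonneg (by linarith) hd.le))
  have hlt : B - s₀ < ((⌊(B - s₀) / d⌋₊ : ℝ) + 1) * d :=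
    (div_lt_iff₀ hd).1 (Nat.lt_floor_add_one _)
  have hceil : 2 * B ≤ s * (d * 2 ^ z) := by
    rw [hmul, hs]
    exact (div_le_iff₀ (by positivity)).1 (Nat.le_ceil _)
  refine ⟨⌊(B - s₀) / d⌋₊, ?_, ?_, by linarith, by linarith⟩
  · have h : (⌊(B - s₀) / d⌋₊ : ℝ) ≤ 2 ^ z * s :=
      le_of_mul_le_mul_right (by linarith) hd
    exact_mod_cast h
  · have h : B * (d⁻¹ / 2) = B / 2 / d := by ring
    rw [h, div_le_iff₀ hd]
    linarith
end
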